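/- Let λ ∈ P^+ and μ ∈ Tλ with μ ≠ λ. Then μ ∈ P^+ if and only if every reduced expression of μ begins with an imaginary generator; precisely: μ ∈ P^+ iff for every τ ∈ T with μ = τλ and ℓ(τ) minimal among all σ ∈ T with σλ = μ, and for every factorization τ = r_{i_1}r_{i_2}⋯r_{i_{ℓ(τ)}} with i_k ∈ I, one has i_1 ∈ I^{im}. -/

import Mathlib

namespace GKM

variable {I V : Type*} [AddCommGroup V] [Module ℚ V]

/-- The simple "reflection" `r_i : x ↦ x - α_i^∨(x) • α_i` (an endomorphism of `h*`). -/
def srefl (α : I → V) (coroot : I → (V →ₗ[ℚ] ℚ)) (i : I) : Module.End ℚ V :=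
  LinearMap.id - (coroot i).smulRight (α i)

/-- The dual map `h ↦ h - h(α_i) • α_i^∨` on linear functionals; for a real index `i`
this is `r_i^∨ : h ↦ h ∘ r_i⁻¹ = h ∘ r_i`. -/
def crefl (α : I → V) (coroot : I → (V →ₗ[ℚ] ℚ)) (i : I) :
    Module.End ℚ (V →ₗ[ℚ] ℚ) :=
  LinearMap.id - (LinearMap.applyₗ (α i)).smulRight (coroot i)

/-- The monoid `T` generated by all the `r_i`, `i ∈ I`. -/
def Tmon (α : I → V) (coroot : I → (V →ₗ[ℚ] ℚ)) : Submonoid (Module.End ℚ V) :=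
  Submonoid.closure (Set.range (srefl α coroot))

/-- The Weyl group `W` generated by the `r_i` with `i` real; since each generator is an
involution, the submonoid it generates coincides with the group it generates. -/
def Wmon (A : I → I → ℤ) (α : I → V) (coroot : I → (V →ₗ[ℚ] ℚ)) :
    Submonoid (Module.End ℚ V) :=
  Submonoid.closure (srefl α coroot '' {i | A i i = 2})

/-- `Q^+`, the set of `ℕ`-linear combinations of simple roots. -/
def Qplus (α : I → V) : Set V :=
  {x | ∃ c : I →₀ ℕ, x = c.sum fun i n => (n : ℚ) • α i}

/-- The weight lattice `P`. -/
def Pint (coroot : I → (V →ₗ[ℚ] ℚ)) : Set V :=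
  {x | ∀ i, ∃ n : ℤ, coroot i x = (n : ℚ)}

/-- The dominant integral weights `P^+`. -/
def Pplus (coroot : I → (V →ₗ[ℚ] ℚ)) : Set V :=
  {x | (∀ i, ∃ n : ℤ, coroot i x = (n : ℚ)) ∧ ∀ i, 0 ≤ coroot i x}

/-- The orbit `Tλ`. -/
def Torbit (α : I → V) (coroot : I → (V →ₗ[ℚ] ℚ)) (lam : V) : Set V :=
  {x | ∃ τ, τ ∈ Tmon α coroot ∧ τ lam = x}

/-- The reduced length of `τ ∈ T` with respect to all generators `r_i`, `i ∈ I`. -/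
noncomputable def lenT (α : I → V) (coroot : I → (V →ₗ[ℚ] ℚ))
    (τ : Module.End ℚ V) : ℕ :=
  sInf {n | ∃ l : List I, l.length = n ∧ (l.map (srefl α coroot)).prod = τ}

/-- The reduced length of `w ∈ W` with respect to the real generators. -/
noncomputable def lenW (A : I → I → ℤ) (α : I → V) (coroot : I → (V →ₗ[ℚ] ℚ))
    (w : Module.End ℚ V) : ℕ :=
  sInf {n | ∃ l : List I, (∀ m ∈ l, A m m = 2) ∧ l.length = n ∧
    (l.map (srefl α coroot)).prod = w}

/-- The reflection `r_β : x ↦ x - β^∨(x) • β` attached to a root/coroot pair. -/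
def reflRoot (β : V) (βv : V →ₗ[ℚ] ℚ) : Module.End ℚ V :=
  LinearMap.id - βv.smulRight β

/-- A presentation of `β = w α_k ∈ WΠ` together with its coroot `β^∨ = w^∨ α_k^∨`,
via a word `l` (with real entries) for `w`. -/
def IsWRootPres (A : I → I → ℤ) (α : I → V) (coroot : I → (V →ₗ[ℚ] ℚ))
    (l : List I) (k : I) (β : V) (βv : V →ₗ[ℚ] ℚ) : Prop :=
  (∀ m ∈ l, A m m = 2) ∧
  β = (l.map (srefl α coroot)).prod (α k) ∧
  βv = (l.map (crefl α coroot)).prod (coroot k)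

/-- `β ∈ WΠ` with coroot `β^∨`. -/
def IsWRootPair (A : I → I → ℤ) (α : I → V) (coroot : I → (V →ₗ[ℚ] ℚ))
    (β : V) (βv : V →ₗ[ℚ] ℚ) : Prop :=
  ∃ l k, IsWRootPres A α coroot l k β βv

/-- A chain `ν =: c s ← ⋯ ← c 0 := μ` of length `s` inside `Tλ`:
`c k = r_{β k} (c (k+1))` with `β k ∈ WΠ ∩ Q^+` and `(β k)^∨(c (k+1)) > 0`. -/
def IsChain (A : I → I → ℤ) (α : I → V) (coroot : I → (V →ₗ[ℚ] ℚ))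
    (lam μ ν : V) (s : ℕ) (c : ℕ → V) (β : ℕ → V)
    (βv : ℕ → (V →ₗ[ℚ] ℚ)) : Prop :=
  c 0 = μ ∧ c s = ν ∧ (∀ k ≤ s, c k ∈ Torbit α coroot lam) ∧
  ∀ k < s, IsWRootPair A α coroot (β k) (βv k) ∧ β k ∈ Qplus α ∧
    0 < βv k (c (k+1)) ∧ c k = c (k+1) - βv k (c (k+1)) • β k

/-- `μ > ν` in `Tλ`. -/
def ChainGT (A : I → I → ℤ) (α : I → V) (coroot : I → (V →ₗ[ℚ] ℚ))
    (lam μ ν : V) : Prop :=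
  ∃ s, 1 ≤ s ∧ ∃ c β βv, IsChain A α coroot lam μ ν s c β βv

/-- `dist(μ, ν) = n`: there is a chain of length `n` from `μ` to `ν` and every chain
has length at most `n`. -/
def distEq (A : I → I → ℤ) (α : I → V) (coroot : I → (V →ₗ[ℚ] ℚ))
    (lam μ ν : V) (n : ℕ) : Prop :=
  (∃ c β βv, IsChain A α coroot lam μ ν n c β βv) ∧
  ∀ m c β βv, IsChain A α coroot lam μ ν m c β βv → m ≤ n

/-- An `a`-chain for `(μ, ν)`: a chain in which each step is a covering
(`dist = 1`), `a·β_k^∨(ν_k)` is a positive integer for steps along `WΠ_re`,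
and `a·β_k^∨(ν_k) = 1` for steps along `WΠ_im`.  The index `ks k` records the simple
root of which `β k` is a `W`-translate. -/
def IsAChain (A : I → I → ℤ) (α : I → V) (coroot : I → (V →ₗ[ℚ] ℚ))
    (lam : V) (a : ℚ) (μ ν : V) (s : ℕ) (c : ℕ → V)
    (β : ℕ → V) (βv : ℕ → (V →ₗ[ℚ] ℚ)) (ks : ℕ → I) : Prop :=
  1 ≤ s ∧ IsChain A α coroot lam μ ν s c β βv ∧
  ∀ k < s,
    (∃ l, IsWRootPres A α coroot l (ks k) (β k) (βv k)) ∧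
    distEq A α coroot lam (c k) (c (k+1)) 1 ∧
    (A (ks k) (ks k) = 2 → ∃ n : ℕ, 0 < n ∧ a * βv k (c (k+1)) = (n : ℚ)) ∧
    (A (ks k) (ks k) ≠ 2 → a * βv k (c (k+1)) = 1)

/-- Existence of an `a`-chain for `(μ, ν)`. -/
def HasAChain (A : I → I → ℤ) (α : I → V) (coroot : I → (V →ₗ[ℚ] ℚ))
    (lam : V) (a : ℚ) (μ ν : V) : Prop :=
  ∃ s c β βv ks, IsAChain A α coroot lam a μ ν s c β βv ks

/-- The piecewise-linear path attached to GLS data `(λ_1, …, λ_s ; a_0, …, a_s)`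
(weights indexed `1, …, s`, breakpoints indexed `0, …, s`):
on `[a_{j-1}, a_j]` it equals `Σ_{k<j} (a_k - a_{k-1}) • λ_k + (t - a_{j-1}) • λ_j`. -/
def glsPath (lamseq : ℕ → V) (a : ℕ → ℚ) (s : ℕ) (t : ℚ) : V :=
  ∑ k ∈ Finset.range s, (max (min t (a (k+1)) - a k) 0) • lamseq (k+1)

/-- The data of a Generalized Lakshmibai–Seshadri path of shape `lam`. -/
def IsGLS (A : I → I → ℤ) (α : I → V) (coroot : I → (V →ₗ[ℚ] ℚ))
    (lam : V) (s : ℕ) (lamseq : ℕ → V) (a : ℕ → ℚ) : Prop :=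
  1 ≤ s ∧ a 0 = 0 ∧ a s = 1 ∧ (∀ k < s, a k < a (k+1)) ∧
  (∀ k, 1 ≤ k → k ≤ s → lamseq k ∈ Torbit α coroot lam) ∧
  (∀ k, 1 ≤ k → k < s →
    HasAChain A α coroot lam (a k) (lamseq k) (lamseq (k+1))) ∧
  (lamseq s = lam ∨ HasAChain A α coroot lam 1 (lamseq s) lam)

/-- The set `ℙ_λ` of Generalized Lakshmibai–Seshadri paths of shape `lam`,
realized as functions `ℚ → V` via `glsPath`. -/
def GLSset (A : I → I → ℤ) (α : I → V) (coroot : I → (V →ₗ[ℚ] ℚ))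
    (lam : V) : Set (ℚ → V) :=
  {π | ∃ s lamseq a, IsGLS A α coroot lam s lamseq a ∧ π = glsPath lamseq a s}

/-- `h_i^π(t) = α_i^∨(π(t))`. -/
def hFun (coroot : I → (V →ₗ[ℚ] ℚ)) (i : I) (π : ℚ → V) (t : ℚ) : ℚ :=
  coroot i (π t)

/-- `m_i^π`, the minimal integer value attained by `h_i^π` on `[0,1]`. -/
noncomputable def mOf (coroot : I → (V →ₗ[ℚ] ℚ)) (i : I) (π : ℚ → V) : ℤ :=
  sInf {n : ℤ | ∃ t, 0 ≤ t ∧ t ≤ 1 ∧ hFun coroot i π t = (n : ℚ)}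

/-- Two paths agree on `[0,1]`. -/
def pathEq (π π' : ℚ → V) : Prop := ∀ t, 0 ≤ t → t ≤ 1 → π t = π' t

/-- `tp = f_+^i(π)`: the largest point of `[0,1]` where `h_i^π` equals `m_i^π`. -/
def IsFPlus (coroot : I → (V →ₗ[ℚ] ℚ)) (i : I) (π : ℚ → V) (tp : ℚ) : Prop :=
  0 ≤ tp ∧ tp ≤ 1 ∧ hFun coroot i π tp = (mOf coroot i π : ℚ) ∧
  ∀ t, 0 ≤ t → t ≤ 1 → hFun coroot i π t = (mOf coroot i π : ℚ) → t ≤ tp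

/-- `tm = f_-^i(π)`: the smallest point of `[tp,1]` where `h_i^π` equals `m_i^π + 1`. -/
def IsFMinus (coroot : I → (V →ₗ[ℚ] ℚ)) (i : I) (π : ℚ → V) (tp tm : ℚ) : Prop :=
  tp ≤ tm ∧ tm ≤ 1 ∧ hFun coroot i π tm = (mOf coroot i π : ℚ) + 1 ∧
  ∀ t, tp ≤ t → t ≤ 1 → hFun coroot i π t = (mOf coroot i π : ℚ) + 1 → tm ≤ t

/-- The path `f_i π` (for cutting data `tp = f_+^i(π)`, `tm = f_-^i(π)`). -/
def fPath (α : I → V) (coroot : I → (V →ₗ[ℚ] ℚ)) (i : I) (tp tm : ℚ)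
    (π : ℚ → V) (t : ℚ) : V :=
  if t ≤ tp then π t
  else if t ≤ tm then π tp + srefl α coroot i (π t - π tp)
  else π t - α i

/-- `π' = f_i π ≠ 0` (equality of paths on `[0,1]`). -/
def FRel (α : I → V) (coroot : I → (V →ₗ[ℚ] ℚ)) (i : I) (π π' : ℚ → V) : Prop :=
  ∃ tp tm, IsFPlus coroot i π tp ∧ tp < 1 ∧ IsFMinus coroot i π tp tm ∧
    pathEq π' (fPath α coroot i tp tm π)

/-- `tp = e_+^i(π)` (`i` real): smallest point of `[0,1]` where `h_i^π = m_i^π`. -/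
def IsEPlusRe (coroot : I → (V →ₗ[ℚ] ℚ)) (i : I) (π : ℚ → V) (tp : ℚ) : Prop :=
  0 ≤ tp ∧ tp ≤ 1 ∧ hFun coroot i π tp = (mOf coroot i π : ℚ) ∧
  ∀ t, 0 ≤ t → t ≤ 1 → hFun coroot i π t = (mOf coroot i π : ℚ) → tp ≤ t

/-- `tm = e_-^i(π)` (`i` real): largest point of `[0,tp]` where `h_i^π = m_i^π + 1`. -/
def IsEMinusRe (coroot : I → (V →ₗ[ℚ] ℚ)) (i : I) (π : ℚ → V) (tp tm : ℚ) : Prop :=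
  0 ≤ tm ∧ tm ≤ tp ∧ hFun coroot i π tm = (mOf coroot i π : ℚ) + 1 ∧
  ∀ t, 0 ≤ t → t ≤ tp → hFun coroot i π t = (mOf coroot i π : ℚ) + 1 → t ≤ tm

/-- The path `e_i π` for `i` real. -/
def ePathRe (α : I → V) (coroot : I → (V →ₗ[ℚ] ℚ)) (i : I) (tm tp : ℚ)
    (π : ℚ → V) (t : ℚ) : V :=
  if t ≤ tm then π t
  else if t ≤ tp then π tm + srefl α coroot i (π t - π tm)
  else π t + α i

/-- `π' = e_i π ≠ 0` for a real index `i`. -/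
def ERelRe (α : I → V) (coroot : I → (V →ₗ[ℚ] ℚ)) (i : I) (π π' : ℚ → V) : Prop :=
  ∃ tp tm, IsEPlusRe coroot i π tp ∧ 0 < tp ∧ IsEMinusRe coroot i π tp tm ∧
    pathEq π' (ePathRe α coroot i tm tp π)

/-- The "inverse reflection" `r_i^{-1} : x ↦ x + (1/(1-a_{ii})) α_i^∨(x) α_i`
for an imaginary index `i`. -/
def rinv (A : I → I → ℤ) (α : I → V) (coroot : I → (V →ₗ[ℚ] ℚ)) (i : I) :
    Module.End ℚ V :=
  LinearMap.id + (1 / (1 - (A i i : ℚ))) • (coroot i).smulRight (α i)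

/-- `tp = e_+^i(π)` (`i` imaginary): smallest point of `[tm,1]` where
`h_i^π = m_i^π + 1 - a_{ii}` (here `tm = e_-^i(π) = f_+^i(π)`). -/
def IsEPlusIm (A : I → I → ℤ) (coroot : I → (V →ₗ[ℚ] ℚ)) (i : I) (π : ℚ → V)
    (tm tp : ℚ) : Prop :=
  tm ≤ tp ∧ tp ≤ 1 ∧
  hFun coroot i π tp = (mOf coroot i π : ℚ) + 1 - (A i i : ℚ) ∧
  ∀ t, tm ≤ t → t ≤ 1 →
    hFun coroot i π t = (mOf coroot i π : ℚ) + 1 - (A i i : ℚ) → tp ≤ t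

/-- The path `e_i π` for `i` imaginary. -/
def ePathIm (A : I → I → ℤ) (α : I → V) (coroot : I → (V →ₗ[ℚ] ℚ)) (i : I)
    (tm tp : ℚ) (π : ℚ → V) (t : ℚ) : V :=
  if t ≤ tm then π t
  else if t ≤ tp then π tm + rinv A α coroot i (π t - π tm)
  else π t + α i

/-- `π' = e_i π ≠ 0` for an imaginary index `i`:  `e_-^i(π) = f_+^i(π) < 1`, the point
`e_+^i(π)` exists, and `h_i^π` never drops to `m_i^π - a_{ii}` on `[e_+^i(π), 1]`. -/
def ERelIm (A : I → I → ℤ) (α : I → V) (coroot : I → (V →ₗ[ℚ] ℚ)) (i : I)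
    (π π' : ℚ → V) : Prop :=
  ∃ tm tp, IsFPlus coroot i π tm ∧ tm < 1 ∧ IsEPlusIm A coroot i π tm tp ∧
    (∀ t, tp ≤ t → t ≤ 1 →
      (mOf coroot i π : ℚ) - (A i i : ℚ) < hFun coroot i π t) ∧
    pathEq π' (ePathIm A α coroot i tm tp π)

/-- `π' = e_i π ≠ 0`. -/
def ERel (A : I → I → ℤ) (α : I → V) (coroot : I → (V →ₗ[ℚ] ℚ)) (i : I)
    (π π' : ℚ → V) : Prop :=
  (A i i = 2 ∧ ERelRe α coroot i π π') ∨ (A i i ≠ 2 ∧ ERelIm A α coroot i π π')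

/-- `π' = f_{i_1} ⋯ f_{i_k} π ≠ 0` for a list `[i_1, …, i_k]` (rightmost acts first). -/
def FMonRel (α : I → V) (coroot : I → (V →ₗ[ℚ] ℚ)) :
    List I → (ℚ → V) → (ℚ → V) → Prop
  | [], π, π' => pathEq π π'
  | i :: l, π, π' => ∃ πm, FMonRel α coroot l π πm ∧ FRel α coroot i πm π'

/-- A generalized crystal for the Borcherds–Cartan datum `(A, α, coroot)`. -/
structure GenCrystal (A : I → I → ℤ) (α : I → V)
    (coroot : I → (V →ₗ[ℚ] ℚ)) where
  B : Type*
  wt : B → V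
  wt_int : ∀ (i : I) (b : B), ∃ n : ℤ, coroot i (wt b) = (n : ℚ)
  eps : I → B → WithBot ℤ
  phi : I → B → WithBot ℤ
  e : I → B → Option B
  f : I → B → Option B
  phi_eq : ∀ (i : I) (b : B) (n : ℤ), (n : ℚ) = coroot i (wt b) →
    phi i b = eps i b + (n : WithBot ℤ)
  wt_e : ∀ (i : I) (b b' : B), e i b = some b' → wt b' = wt b + α i
  eps_e_re : ∀ (i : I) (b b' : B), A i i = 2 → e i b = some b' →
    eps i b' = eps i b + ((-1 : ℤ) : WithBot ℤ)
  eps_e_im : ∀ (i : I) (b b' : B), A i i ≠ 2 → e i b = some b' →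
    eps i b' = eps i b
  e_iff_f : ∀ (i : I) (b b' : B), e i b = some b' ↔ f i b' = some b
  phi_bot : ∀ (i : I) (b : B), phi i b = ⊥ → e i b = none ∧ f i b = none
  eps_im : ∀ (i : I) (b : B), A i i ≠ 2 → eps i b ≤ 0
  phi_im : ∀ (i : I) (b : B), A i i ≠ 2 → phi i b = ⊥ ∨ 0 ≤ phi i b

/-- Finite "orthogonal" subsets of the imaginary simple roots, encoded by their
index sets: `F ∈ 𝒫(Π_im)`. -/
def PImSet (A : I → I → ℤ) (F : Finset I) : Prop :=
  (∀ i ∈ F, A i i ≠ 2) ∧ ∀ i ∈ F, ∀ j ∈ F, i ≠ j → A i j = 0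

end GKM

namespace GKM

theorem srefl_apply {I V : Type*} [AddCommGroup V] [Module ℚ V] (α : I → V)
    (coroot : I → (V →ₗ[ℚ] ℚ)) (i : I) (x : V) :
    srefl α coroot i x = x - coroot i x • α i := by
  simp [srefl]

theorem srefl_srefl {I V : Type*} [AddCommGroup V] [Module ℚ V] {A : I → I → ℤ} {α : I → V}
    {coroot : I → (V →ₗ[ℚ] ℚ)} (hpair : ∀ i j, coroot i (α j) = (A i j : ℚ)) {i : I}
    (hi : A i i = 2) (y : V) : srefl α coroot i (srefl α coroot i y) = y := by
  simp only [srefl_apply, map_sub, map_smul, hpair, hi]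
  push_cast
  module

/-- `x` is the image of `lam` under a word of length `n` in the simple reflections. -/
def HasWord {I V : Type*} [AddCommGroup V] [Module ℚ V] (α : I → V)
    (coroot : I → (V →ₗ[ℚ] ℚ)) (lam : V) (n : ℕ) (x : V) : Prop :=
  ∃ l : List I, l.length = n ∧ (l.map (srefl α coroot)).prod lam = x

theorem HasWord.cons {I V : Type*} [AddCommGroup V] [Module ℚ V] {α : I → V}
    {coroot : I → (V →ₗ[ℚ] ℚ)} {lam : V} {n : ℕ} {x : V}
    (h : HasWord α coroot lam n x) (i : I) :
    HasWord α coroot lam (n + 1) (srefl α coroot i x) := by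
  obtain ⟨l, rfl, rfl⟩ := h
  exact ⟨i :: l, rfl, by simp⟩

theorem prod_srefl_mem_Tmon {I V : Type*} [AddCommGroup V] [Module ℚ V] (α : I → V)
    (coroot : I → (V →ₗ[ℚ] ℚ)) (l : List I) :
    (l.map (srefl α coroot)).prod ∈ Tmon α coroot := by
  refine Submonoid.list_prod_mem _ fun x hx => ?_
  obtain ⟨i, -, rfl⟩ := List.mem_map.1 hx
  exact Submonoid.subset_closure ⟨i, rfl⟩

theorem exists_word_of_mem_Tmon {I V : Type*} [AddCommGroup V] [Module ℚ V] {α : I → V}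
    {coroot : I → (V →ₗ[ℚ] ℚ)} {τ : Module.End ℚ V} (hτ : τ ∈ Tmon α coroot) :
    ∃ l : List I, (l.map (srefl α coroot)).prod = τ := by
  induction hτ using Submonoid.closure_induction with
  | mem x hx => obtain ⟨i, rfl⟩ := hx; exact ⟨[i], by simp⟩
  | one => exact ⟨[], by simp⟩
  | mul x y _ _ hx hy =>
    obtain ⟨l, rfl⟩ := hx
    obtain ⟨l', rfl⟩ := hy
    exact ⟨l ++ l', by simp⟩

theorem lenT_prod_le {I V : Type*} [AddCommGroup V] [Module ℚ V] (α : I → V)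
    (coroot : I → (V →ₗ[ℚ] ℚ)) (l : List I) :
    lenT α coroot (l.map (srefl α coroot)).prod ≤ l.length :=
  Nat.sInf_le ⟨l, rfl, rfl⟩

theorem exists_word_length_eq_lenT {I V : Type*} [AddCommGroup V] [Module ℚ V] {α : I → V}
    {coroot : I → (V →ₗ[ℚ] ℚ)} {τ : Module.End ℚ V} (hτ : τ ∈ Tmon α coroot) :
    ∃ l : List I, l.length = lenT α coroot τ ∧ (l.map (srefl α coroot)).prod = τ := by
  obtain ⟨l, hl⟩ := exists_word_of_mem_Tmon hτ
  exact Nat.sInf_mem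
    (s := {n | ∃ l : List I, l.length = n ∧ (l.map (srefl α coroot)).prod = τ})
    ⟨l.length, l, rfl, hl⟩

/-- The pairings on the orbit of a dominant integral weight are integers. -/
theorem HasWord.coroot_int {I V : Type*} [AddCommGroup V] [Module ℚ V]
    {A : I → I → ℤ} {α : I → V} {coroot : I → (V →ₗ[ℚ] ℚ)}
    (hpair : ∀ i j, coroot i (α j) = (A i j : ℚ)) {lam : V}
    (hlam : ∀ i, ∃ n : ℤ, coroot i lam = (n : ℚ)) {n : ℕ} {x : V}
    (h : HasWord α coroot lam n x) (i : I) : ∃ n : ℤ, coroot i x = (n : ℚ) := by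
  obtain ⟨l, -, rfl⟩ := h
  induction l generalizing i with
  | nil => simpa using hlam i
  | cons k l ih =>
    obtain ⟨u, hu⟩ := ih i
    obtain ⟨v, hv⟩ := ih k
    refine ⟨u - v * A i k, ?_⟩
    simp [srefl_apply, hu, hv, hpair]

/-- When the product of the off-diagonal entries is at least four, two reflections admit
an infinite alternating descent. -/
theorem not_descent_of_four_le {S : ℕ → ℚ → ℚ → Prop} {n : ℕ} {p q a b : ℚ}
    (ha : 0 < a) (hb : 0 < b) (hab : 4 ≤ a * b)
    (di : ∀ m s t, m < n → S m s t → p + 2 * s - a * t < 0 →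
      ∃ m' < m, S m' (-s - p + a * t) t)
    (dj : ∀ m s t, m < n → S m s t → q + 2 * t - b * s < 0 →
      ∃ m' < m, S m' s (-t - q + b * s)) (m : ℕ) :
    ∀ s t, m < n → S m s t →
      (¬ (0 < q + 2 * t - b * s ∧
        2 * (q + 2 * t - b * s) ≤ b * -(p + 2 * s - a * t))) ∧
      ¬ (0 < p + 2 * s - a * t ∧
        2 * (p + 2 * s - a * t) ≤ a * -(q + 2 * t - b * s)) := by
  induction m using Nat.strong_induction_on with
  | _ m ih =>
    refine fun s t hm hS => ⟨fun ⟨h1, h2⟩ => ?_, fun ⟨h1, h2⟩ => ?_⟩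
    · have h3 : p + 2 * s - a * t < 0 := by
        by_contra! h
        nlinarith
      obtain ⟨m', hm', hS'⟩ := di m s t hm hS h3
      refine (ih m' hm' _ _ (hm'.trans hm) hS').2 ⟨by linarith, ?_⟩
      generalize hv : q + 2 * t - b * s = v at *
      generalize hu : p + 2 * s - a * t = u at *
      have e1 : p + 2 * (-s - p + a * t) - a * t = -u := by rw [← hu]; ring
      have e2 : q + 2 * t - b * (-s - p + a * t) = v + b * u := by rw [← hu, ← hv]; ring
      rw [e1, e2]
      nlinarith [mul_le_mul_of_nonneg_left h2 ha.le,
        mul_le_mul_of_nonneg_right hab (neg_pos.2 h3).le]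
    · have h3 : q + 2 * t - b * s < 0 := by
        by_contra! h
        nlinarith
      obtain ⟨m', hm', hS'⟩ := dj m s t hm hS h3
      refine (ih m' hm' _ _ (hm'.trans hm) hS').1 ⟨by linarith, ?_⟩
      generalize hv : q + 2 * t - b * s = v at *
      generalize hu : p + 2 * s - a * t = u at *
      have e1 : p + 2 * s - a * (-t - q + b * s) = u + a * v := by rw [← hu, ← hv]; ring
      have e2 : q + 2 * (-t - q + b * s) - b * s = -v := by rw [← hv]; ring
      rw [e1, e2]
      nlinarith [mul_le_mul_of_nonneg_left h2 hb.le,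
        mul_le_mul_of_nonneg_right hab (neg_pos.2 h3).le]

/-- The exchange property for two real reflections, in coordinates: `S m s t` stands for
`x + s • α_i + t • α_j` having a word of length `m`, with `p`, `q` the pairings of `x`. -/
theorem exchange_coord {S : ℕ → ℚ → ℚ → Prop} {n : ℕ} {p q : ℚ} {a b : ℤ}
    (ha : 0 ≤ a) (hb : 0 ≤ b) (hab : a = 0 ↔ b = 0)
    (ui : ∀ m s t, S m s t → S (m + 1) (-s - p + a * t) t)
    (uj : ∀ m s t, S m s t → S (m + 1) s (-t - q + b * s))
    (di : ∀ m s t, m < n → S m s t → p + 2 * s - a * t < 0 →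
      ∃ m' < m, S m' (-s - p + a * t) t)
    (dj : ∀ m s t, m < n → S m s t → q + 2 * t - b * s < 0 →
      ∃ m' < m, S m' s (-t - q + b * s))
    (hp : p < 0) (hq : q < 0) {m₁ : ℕ} (hm₁ : m₁ < n) (h₁ : S m₁ 0 (-q)) :
    ∃ m < n, S m (-p) 0 := by
  obtain ⟨m₂, hm₂, h₂⟩ := di m₁ _ _ hm₁ h₁ (by
    have : (0 : ℚ) ≤ a := by exact_mod_cast ha
    nlinarith)
  rcases ha.eq_or_lt with rfl | ha'
  · obtain rfl : b = 0 := hab.1 rfl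
    refine ⟨m₂ + 1, by omega, ?_⟩
    convert uj _ _ _ h₂ using 1 <;> push_cast <;> ring
  have hb' : 0 < b := by omega
  rcases le_or_gt 4 (a * b) with h4 | h4
  · have ha1 : (0 : ℚ) < a := by exact_mod_cast ha'
    have hb1 : (0 : ℚ) < b := by exact_mod_cast hb'
    have h41 : (4 : ℚ) ≤ a * b := by exact_mod_cast h4
    refine absurd ⟨?_, ?_⟩ (not_descent_of_four_le ha1 hb1 h41 di dj m₁ _ _ hm₁ h₁).1
    · linarith
    · nlinarith [mul_pos hb1 (neg_pos.2 hp),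
        mul_le_mul_of_nonneg_right h41 (neg_pos.2 hq).le]
  have ha3 : a ≤ 3 := by nlinarith
  have hb3 : b ≤ 3 := by nlinarith
  clear hab ha hb
  interval_cases a <;> interval_cases b <;> first | omega | skip
  · obtain ⟨m₃, hm₃, h₃⟩ := dj m₂ _ _ (by omega) h₂ (by push_cast; linarith)
    refine ⟨m₃ + 1 + 1, by omega, ?_⟩
    convert uj _ _ _ (ui _ _ _ h₃) using 1 <;> push_cast <;> ring
  · obtain ⟨m₃, hm₃, h₃⟩ := dj m₂ _ _ (by omega) h₂ (by push_cast; linarith)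
    obtain ⟨m₄, hm₄, h₄⟩ := di m₃ _ _ (by omega) h₃ (by push_cast; linarith)
    refine ⟨m₄ + 1 + 1 + 1, by omega, ?_⟩
    convert uj _ _ _ (ui _ _ _ (uj _ _ _ h₄)) using 1 <;> push_cast <;> ring
  · obtain ⟨m₃, hm₃, h₃⟩ := dj m₂ _ _ (by omega) h₂ (by push_cast; linarith)
    obtain ⟨m₄, hm₄, h₄⟩ := di m₃ _ _ (by omega) h₃ (by push_cast; linarith)
    obtain ⟨m₅, hm₅, h₅⟩ := dj m₄ _ _ (by omega) h₄ (by push_cast; linarith)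
    obtain ⟨m₆, hm₆, h₆⟩ := di m₅ _ _ (by omega) h₅ (by push_cast; linarith)
    refine ⟨m₆ + 1 + 1 + 1 + 1 + 1, by omega, ?_⟩
    convert uj _ _ _ (ui _ _ _ (uj _ _ _ (ui _ _ _ (uj _ _ _ h₆)))) using 1 <;>
      push_cast <;> ring
  · obtain ⟨m₃, hm₃, h₃⟩ := dj m₂ _ _ (by omega) h₂ (by push_cast; linarith)
    obtain ⟨m₄, hm₄, h₄⟩ := di m₃ _ _ (by omega) h₃ (by push_cast; linarith)
    refine ⟨m₄ + 1 + 1 + 1, by omega, ?_⟩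
    convert uj _ _ _ (ui _ _ _ (uj _ _ _ h₄)) using 1 <;> push_cast <;> ring
  · obtain ⟨m₃, hm₃, h₃⟩ := dj m₂ _ _ (by omega) h₂ (by push_cast; linarith)
    obtain ⟨m₄, hm₄, h₄⟩ := di m₃ _ _ (by omega) h₃ (by push_cast; linarith)
    obtain ⟨m₅, hm₅, h₅⟩ := dj m₄ _ _ (by omega) h₄ (by push_cast; linarith)
    obtain ⟨m₆, hm₆, h₆⟩ := di m₅ _ _ (by omega) h₅ (by push_cast; linarith)
    refine ⟨m₆ + 1 + 1 + 1 + 1 + 1, by omega, ?_⟩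
    convert uj _ _ _ (ui _ _ _ (uj _ _ _ (ui _ _ _ (uj _ _ _ h₆)))) using 1 <;>
      push_cast <;> ring

/-- On the orbit of a dominant weight, a real simple reflection with negative pairing
shortens words, and imaginary simple coroots are nonnegative. -/
theorem HasWord.exchange {I V : Type*} [AddCommGroup V] [Module ℚ V]
    {A : I → I → ℤ} {α : I → V} {coroot : I → (V →ₗ[ℚ] ℚ)}
    (hpair : ∀ i j, coroot i (α j) = (A i j : ℚ))
    (hdiag : ∀ i, A i i = 2 ∨ A i i ≤ 0)
    (hoff : ∀ i j, i ≠ j → A i j ≤ 0)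
    (hzero : ∀ i j, A i j = 0 ↔ A j i = 0)
    {lam : V} (hlam : ∀ i, 0 ≤ coroot i lam) (n : ℕ) :
    ∀ x, HasWord α coroot lam n x →
      (∀ i, A i i = 2 → coroot i x < 0 →
        ∃ m < n, HasWord α coroot lam m (srefl α coroot i x)) ∧
      ∀ i, A i i ≠ 2 → 0 ≤ coroot i x := by
  have hcoroot : ∀ i j y, coroot i (srefl α coroot j y) =
      coroot i y - coroot j y * A i j := by
    intro i j y
    simp [srefl_apply, hpair]
  induction n using Nat.strong_induction_on with
  | _ n ih =>
    rintro x ⟨l, hl, hx⟩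
    cases l with
    | nil =>
      obtain rfl : lam = x := by simpa using hx
      exact ⟨fun i _ h => absurd (hlam i) h.not_ge, fun i _ => hlam i⟩
    | cons j l =>
      set x₁ := (l.map (srefl α coroot)).prod lam with hx₁
      have hw₁ : HasWord α coroot lam l.length x₁ := ⟨l, rfl, rfl⟩
      have hxj : srefl α coroot j x₁ = x := by simpa using hx
      rw [List.length_cons] at hl
      have hln : l.length < n := by omega
      by_cases hshort : ∃ m < n, HasWord α coroot lam m x
      · obtain ⟨m, hm, hwm⟩ := hshort
        refine ⟨fun i hi hneg => ?_, (ih m hm x hwm).2⟩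
        obtain ⟨m', hm', h⟩ := (ih m hm x hwm).1 i hi hneg
        exact ⟨m', hm'.trans hm, h⟩
      have hj0 : 0 ≤ coroot j x₁ := by
        by_cases hj : A j j = 2
        · by_contra! hneg
          obtain ⟨m, hm, h⟩ := (ih _ hln x₁ hw₁).1 j hj hneg
          exact hshort ⟨m, hm.trans hln, hxj ▸ h⟩
        · exact (ih _ hln x₁ hw₁).2 j hj
      refine ⟨fun i hi hneg => ?_, fun i hi => ?_⟩
      · rcases eq_or_ne i j with rfl | hij
        · exact ⟨_, hln, by rw [← hxj, srefl_srefl hpair hi]; exact hw₁⟩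
        have haij := hoff i j hij
        have haji := hoff j i hij.symm
        have haij' : (A i j : ℚ) ≤ 0 := by exact_mod_cast haij
        by_cases hj : A j j = 2
        · have hjpos : 0 < coroot j x₁ := by
            refine lt_of_le_of_ne hj0 fun h0 => hshort ⟨_, hln, ?_⟩
            rwa [← hxj, srefl_apply, ← h0, zero_smul, sub_zero]
          have hjx : coroot j x = -coroot j x₁ := by
            rw [← hxj, hcoroot, hj]
            push_cast
            ring
          have ei : ∀ s t : ℚ, srefl α coroot i (x + s • α i + t • α j) =
              x + (-s - coroot i x + ((-A i j : ℤ) : ℚ) * t) • α i + t • α j := by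
            intro s t
            simp only [srefl_apply, map_add, map_smul, hpair, hi]
            push_cast
            module
          have ej : ∀ s t : ℚ, srefl α coroot j (x + s • α i + t • α j) =
              x + s • α i + (-t - coroot j x + ((-A j i : ℤ) : ℚ) * s) • α j := by
            intro s t
            simp only [srefl_apply, map_add, map_smul, hpair, hj]
            push_cast
            module
          obtain ⟨m, hm, h⟩ := exchange_coord
            (S := fun m s t => HasWord α coroot lam m (x + s • α i + t • α j))
            (n := n) (p := coroot i x) (q := coroot j x) (a := -A i j) (b := -A j i)
            (by omega) (by omega) (by simpa using hzero i j)
            (fun m s t h => ei s t ▸ h.cons i) (fun m s t h => ej s t ▸ h.cons j)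
            (fun m s t hm h hlt => ei s t ▸ (ih m hm _ h).1 i hi (by
              simp only [map_add, map_smul, hpair, hi, smul_eq_mul]
              push_cast at hlt ⊢
              linarith))
            (fun m s t hm h hlt => ej s t ▸ (ih m hm _ h).1 j hj (by
              simp only [map_add, map_smul, hpair, hj, smul_eq_mul]
              push_cast at hlt ⊢
              linarith))
            hneg (by linarith) hln (by
              convert hw₁ using 1
              rw [hjx, ← hxj, srefl_apply]
              module)
          refine ⟨m, hm, ?_⟩
          convert h using 1
          rw [srefl_apply]
          module
        · have hneg' := hneg
          rw [← hxj, hcoroot] at hneg'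
          have hneg₁ : coroot i x₁ < 0 := by nlinarith
          obtain ⟨m, hm, hw₂⟩ := (ih _ hln x₁ hw₁).1 i hi hneg₁
          rcases haij.eq_or_lt with h0 | hlt
          · refine ⟨m + 1, by omega, ?_⟩
            convert hw₂.cons j using 1
            have h0' := (hzero i j).1 h0
            rw [← hxj]
            simp only [srefl_apply, map_sub, map_smul, hpair, h0, h0']
            push_cast
            module
          · have hlt' : A j i < 0 := lt_of_le_of_ne haji fun h => hlt.ne ((hzero j i).1 h)
            have h2 := (ih m (hm.trans hln) _ hw₂).2 j hj
            rw [hcoroot] at h2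
            have e1 : (A i j : ℚ) ≤ -1 := by exact_mod_cast Int.le_sub_one_of_lt hlt
            have e2 : (A j i : ℚ) ≤ -1 := by exact_mod_cast Int.le_sub_one_of_lt hlt'
            nlinarith
      · rw [← hxj, hcoroot]
        have hij : A i j ≤ 0 := by
          rcases eq_or_ne i j with rfl | hij
          · exact (hdiag i).resolve_left hi
          · exact hoff i j hij
        have hij' : (A i j : ℚ) ≤ 0 := by exact_mod_cast hij
        have := (ih _ hln x₁ hw₁).2 i hi
        nlinarith

end GKM

open GKM in
/-- `μ ∈ Tλ`, `μ ≠ λ`, is dominant iff every reduced expression of `μ` begins with an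
imaginary generator. -/
theorem stmt4 {I V : Type*} [Countable I] [AddCommGroup V] [Module ℚ V]
    (A : I → I → ℤ) (α : I → V) (coroot : I → (V →ₗ[ℚ] ℚ))
    (hind : LinearIndependent ℚ α)
    (hpair : ∀ i j, coroot i (α j) = (A i j : ℚ))
    (hdiag : ∀ i, A i i = 2 ∨ A i i ≤ 0)
    (hoff : ∀ i j, i ≠ j → A i j ≤ 0)
    (hzero : ∀ i j, A i j = 0 ↔ A j i = 0)
    (lam : V) (hlam : lam ∈ Pplus coroot)
    (μ : V) (hμT : μ ∈ Torbit α coroot lam) (hne : μ ≠ lam) :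
    μ ∈ Pplus coroot ↔
      ∀ τ : Module.End ℚ V, τ ∈ Tmon α coroot → τ lam = μ →
        (∀ σ : Module.End ℚ V, σ ∈ Tmon α coroot → σ lam = μ →
          lenT α coroot τ ≤ lenT α coroot σ) →
        ∀ (i₁ : I) (l : List I),
          ((i₁ :: l).map (srefl α coroot)).prod = τ →
          (i₁ :: l).length = lenT α coroot τ →
          A i₁ i₁ ≠ 2 := by
  have hex := HasWord.exchange hpair hdiag hoff hzero hlam.2
  have hword : ∃ n, HasWord α coroot lam n μ := by
    obtain ⟨τ, hτ, rfl⟩ := hμT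
    obtain ⟨l, rfl⟩ := exists_word_of_mem_Tmon hτ
    exact ⟨l.length, l, rfl, rfl⟩
  constructor
  · intro hμ τ _ hτμ hmin i₁ l hprod hlen hreal
    have hshort : ∀ m, HasWord α coroot lam m μ → l.length < m := by
      rintro _ ⟨l', rfl, hl'⟩
      have h1 := hmin _ (prod_srefl_mem_Tmon α coroot l') hl'
      have h2 := lenT_prod_le α coroot l'
      rw [List.length_cons] at hlen
      omega
    set x := (l.map (srefl α coroot)).prod lam with hx
    have hw : HasWord α coroot lam l.length x := ⟨l, rfl, rfl⟩
    have hxμ : srefl α coroot i₁ x = μ := by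
      rw [← hτμ, ← hprod]
      simp [hx]
    have hpos : 0 ≤ coroot i₁ x := by
      by_contra! hneg
      obtain ⟨m, hm, h⟩ := (hex _ x hw).1 i₁ hreal hneg
      exact (hshort m (hxμ ▸ h)).not_gt hm
    have hμpos := hμ.2 i₁
    rw [← hxμ, srefl_apply, map_sub, map_smul, hpair, hreal, smul_eq_mul] at hμpos
    push_cast at hμpos
    have h0 : coroot i₁ x = 0 := by linarith
    refine lt_irrefl _ (hshort _ ?_)
    rwa [← hxμ, srefl_apply, h0, zero_smul, sub_zero]
  · intro H
    have ⟨N, hN⟩ := hword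
    refine ⟨hN.coroot_int hpair hlam.1, fun i => ?_⟩
    by_contra! hneg
    have hi : A i i = 2 := by
      by_contra hi
      exact hneg.not_ge ((hex N μ hN).2 i hi)
    classical
    have hmin : ∀ m, HasWord α coroot lam m μ → Nat.find hword ≤ m :=
      fun m hm => Nat.find_min' hword hm
    obtain ⟨m, hm, l, rfl, hl⟩ := (hex _ μ (Nat.find_spec hword)).1 i hi hneg
    have hprod : ((i :: l).map (srefl α coroot)).prod lam = μ := by
      rw [List.map_cons, List.prod_cons, Module.End.mul_apply, hl, srefl_srefl hpair hi]
    have hle : ∀ σ ∈ Tmon α coroot, σ lam = μ → (i :: l).length ≤ lenT α coroot σ := by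
      intro σ hσ hσμ
      obtain ⟨l', hl', rfl⟩ := exists_word_length_eq_lenT hσ
      have := hmin _ ⟨l', rfl, hσμ⟩
      rw [← hl', List.length_cons]
      omega
    have hmem := prod_srefl_mem_Tmon α coroot (i :: l)
    have hlen := lenT_prod_le α coroot (i :: l)
    exact H _ hmem hprod (fun σ hσ hσμ => hlen.trans (hle σ hσ hσμ)) i l rfl
      ((hle _ hmem hprod).antisymm hlen) hi
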